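/- arXiv:1307.7204 — 2 statements merged into one kernel-verified Lean document; each statement's English description precedes it below -/
import Mathlib

section
/- (Computational content of Theorem 10.3) Let k ≥ 1 be an integer, let l : {1,…,k} → ℕ satisfy 1 ≤ l(i) ≤ i for all i, and let R : {0,…,k} → ℕ satisfy R(0) = 0. Suppose c : {0,…,k} → ℚ satisfies c(0) = 1 and, for each i with 1 ≤ i ≤ k, Σ_{j=i−l(i)}^{i} (−1)^{R(i)+R(j)} c(j)/(i−j)! = 0. Then c(k) = Σ_{n=0}^{k−1} Σ (−1)^{R(k)+n+1} / ((k₀−k₁)! (k₁−k₂)! ⋯ (k_n−k_{n+1})!), where the inner sum is over all integer tuples (k₀, k₁, …, k_{n+1}) with k₀ = k, k_{n+1} = 0, and 1 ≤ k_i − k_{i+1} ≤ l(k_i) for all 0 ≤ i ≤ n. -/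
open Finset

/-- Weighted path counts by recursion on length. -/
def pathP (K : ℕ) (w : ℕ → ℕ → ℚ) : ℕ → ℕ → ℚ
  | 0, i => if i = 0 then 1 else 0
  | m + 1, i => ∑ j : Fin (K + 1), w i j * pathP K w m j

lemma pathP_eq (K : ℕ) (w : ℕ → ℕ → ℚ) (m : ℕ) (i : Fin (K + 1)) :
    ∑ t : Fin (m + 1) → Fin (K + 1),
      (if (t 0 = i ∧ (t (Fin.last m) : ℕ) = 0) then
        ∏ s : Fin m, w (t s.castSucc) (t s.succ) else 0) = pathP K w m i := by
  induction m generalizing i with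
  | zero =>
    rw [← (Fin.consEquiv (fun _ : Fin 1 => Fin (K + 1))).sum_comp, Fintype.sum_prod_type]
    simp only [Fin.consEquiv_apply, pathP]
    rw [Finset.sum_eq_single i]
    · simp
    · intro b _ hb
      simp [hb]
    · simp
  | succ m ih =>
    rw [← (Fin.consEquiv (fun _ : Fin (m + 2) => Fin (K + 1))).sum_comp, Fintype.sum_prod_type]
    simp only [Fin.consEquiv_apply, pathP]
    rw [Finset.sum_eq_single i]
    · simp_rw [← ih, Finset.mul_sum]
      rw [Finset.sum_comm]
      refine Finset.sum_congr rfl fun u _ => ?_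
      rw [Finset.sum_eq_single (u 0)]
      · rw [Fin.prod_univ_succ]
        simp only [← Fin.succ_last, Fin.cons_succ, Fin.cons_zero, Fin.castSucc_zero,
          ← Fin.succ_castSucc, true_and, mul_ite, mul_zero]
      · intro b _ hb
        simp [Ne.symm hb]
      · simp
    · intro b _ hb
      simp [hb]
    · simp

lemma pathP_zero (K : ℕ) (w : ℕ → ℕ → ℚ) (hw : ∀ a b, a ≤ b → w a b = 0) (m : ℕ) :
    ∀ i, i < m → pathP K w m i = 0 := by
  induction m with
  | zero => intro i hi; omega
  | succ m ih =>
    intro i hi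
    simp only [pathP]
    refine Finset.sum_eq_zero fun j _ => ?_
    by_cases h : i ≤ j
    · rw [hw _ _ h, zero_mul]
    · rw [ih j (by omega), mul_zero]

lemma sol_eq (K : ℕ) (w : ℕ → ℕ → ℚ) (hw : ∀ a b, a ≤ b → w a b = 0) (d : ℕ → ℚ)
    (h0 : d 0 = 1)
    (hd : ∀ i, 1 ≤ i → i ≤ K → d i = ∑ j : Fin (K + 1), w i j * d j) (i : ℕ) :
    i ≤ K → d i = ∑ m ∈ range (K + 1), pathP K w m i := by
  induction i using Nat.strong_induction_on with
  | _ i ih =>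
    intro hi
    rcases Nat.eq_zero_or_pos i with rfl | hpos
    · rw [Finset.sum_range_succ', Finset.sum_eq_zero, h0]
      · simp [pathP]
      · intro m _
        exact pathP_zero K w hw _ _ (by omega)
    · have e : ∑ m ∈ range (K + 1), pathP K w m i = ∑ m ∈ range (K + 1), pathP K w (m + 1) i := by
        rw [Finset.sum_range_succ', Finset.sum_range_succ,
          pathP_zero K w hw (K + 1) i (by omega)]
        simp [pathP, hpos.ne']
      rw [e, hd i hpos hi]
      simp only [pathP]
      rw [Finset.sum_comm]
      refine Finset.sum_congr rfl fun j _ => ?_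
      rw [← Finset.mul_sum]
      by_cases h : i ≤ j
      · rw [hw _ _ h, zero_mul, zero_mul]
      · rw [ih j (by omega) (by omega)]

/-- **Computational content of Theorem 10.3:** the explicit solution of the unipotent
triangular system `Σ_{j=i−l(i)}^{i} (−1)^{R(i)+R(j)} c(j)/(i−j)! = 0` with `c(0) = 1`. -/
theorem triangular_system_solution
    (k : ℕ) (hk : 1 ≤ k)
    (l : ℕ → ℕ) (hl : ∀ i, 1 ≤ i → i ≤ k → 1 ≤ l i ∧ l i ≤ i)
    (R : ℕ → ℕ) (hR : R 0 = 0)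
    (c : ℕ → ℚ) (hc0 : c 0 = 1)
    (hsys : ∀ i, 1 ≤ i → i ≤ k →
      ∑ j ∈ Finset.Icc (i - l i) i,
        (-1 : ℚ) ^ (R i + R j) * c j / ((i - j).factorial : ℚ) = 0) :
    c k = ∑ n ∈ Finset.range k,
      ∑ t ∈ Finset.univ.filter (fun t : Fin (n + 2) → Fin (k + 1) =>
          (t 0 : ℕ) = k ∧ (t (Fin.last (n + 1)) : ℕ) = 0 ∧
          ∀ i : Fin (n + 1),
            1 ≤ (t i.castSucc : ℕ) - (t i.succ : ℕ) ∧
            (t i.castSucc : ℕ) - (t i.succ : ℕ) ≤ l (t i.castSucc : ℕ)),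
        (-1 : ℚ) ^ (R k + n + 1) /
          ∏ i : Fin (n + 1), (((t i.castSucc : ℕ) - (t i.succ : ℕ)).factorial : ℚ) := by
  classical
  set w : ℕ → ℕ → ℚ := fun a b =>
    if 1 ≤ a - b ∧ a - b ≤ l a then (-1) / ((a - b).factorial : ℚ) else 0 with hwdef
  have hw : ∀ a b, a ≤ b → w a b = 0 := by
    intro a b hab
    simp only [hwdef]
    rw [if_neg (by omega)]
  have hsq : ∀ r : ℕ, (-1 : ℚ) ^ r * (-1) ^ r = 1 := by
    intro r
    rw [← mul_pow]; norm_num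
  have key := sol_eq k w hw (fun i => (-1) ^ R i * c i) (by simp [hR, hc0]) (by
    intro i h1 hik
    have h := hsys i h1 hik
    obtain ⟨hl1, hl2⟩ := hl i h1 hik
    have e1 : ∑ j : Fin (k + 1), w i j * ((-1) ^ R (j : ℕ) * c j)
        = ∑ j ∈ Finset.Ico (i - l i) i, -((-1) ^ R j * c j / ((i - j).factorial : ℚ)) := by
      rw [Fin.sum_univ_eq_sum_range (fun j => w i j * ((-1) ^ R j * c j)) (k + 1)]
      symm
      refine (Finset.sum_congr rfl fun j hj => ?_).trans
        (Finset.sum_subset (s₁ := Finset.Ico (i - l i) i) ?_ ?_)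
      · rw [Finset.mem_Ico] at hj
        simp only [hwdef]
        rw [if_pos (by omega)]
        ring
      · intro j hj
        rw [Finset.mem_Ico] at hj
        rw [Finset.mem_range]; omega
      · intro j _ hj
        rw [Finset.mem_Ico] at hj
        simp only [hwdef]
        rw [if_neg (by omega), zero_mul]
    have e2 : ∑ j ∈ Finset.Icc (i - l i) i,
        (-1 : ℚ) ^ (R i + R j) * c j / ((i - j).factorial : ℚ) = (-1) ^ R i *
        ((∑ j ∈ Finset.Ico (i - l i) i, ((-1) ^ R j * c j / ((i - j).factorial : ℚ)))
          + (-1) ^ R i * c i) := by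
      rw [← Finset.Ico_insert_right (by omega), Finset.sum_insert (by simp), mul_add,
        Finset.mul_sum, add_comm]
      congr 1
      · refine Finset.sum_congr rfl fun j _ => ?_
        rw [pow_add]; ring
      · rw [pow_add]; simp; ring
    rw [e2] at h
    have h3 := (mul_eq_zero.mp h).resolve_left (pow_ne_zero _ (by norm_num))
    rw [e1, Finset.sum_neg_distrib]
    linarith) k le_rfl
  have hc : c k = (-1) ^ R k * ∑ m ∈ range (k + 1), pathP k w m k := by
    rw [← key, ← mul_assoc, hsq, one_mul]
  rw [hc, Finset.sum_range_succ']
  have hz : pathP k w 0 k = 0 := by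
    simp only [pathP]; rw [if_neg (by omega)]
  rw [hz, add_zero, Finset.mul_sum]
  refine Finset.sum_congr rfl fun n _ => ?_
  have hp := pathP_eq k w (n + 1) (Fin.last k)
  rw [Fin.val_last] at hp
  rw [← hp, Finset.mul_sum, Finset.sum_filter]
  refine Finset.sum_congr rfl fun t _ => ?_
  have ht : t 0 = Fin.last k ↔ (t 0 : ℕ) = k := by
    rw [Fin.ext_iff, Fin.val_last]
  simp only [ht]
  by_cases hA : (t 0 : ℕ) = k ∧ (t (Fin.last (n + 1)) : ℕ) = 0
  · rw [if_pos hA]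
    by_cases hB : ∀ i : Fin (n + 1),
            1 ≤ (t i.castSucc : ℕ) - (t i.succ : ℕ) ∧
            (t i.castSucc : ℕ) - (t i.succ : ℕ) ≤ l (t i.castSucc : ℕ)
    · rw [if_pos ⟨hA.1, hA.2, hB⟩]
      have : ∏ s : Fin (n + 1), w (t s.castSucc) (t s.succ) = ∏ s : Fin (n + 1),
          ((-1 : ℚ) / (((t s.castSucc : ℕ) - (t s.succ : ℕ)).factorial : ℚ)) := by
        refine Finset.prod_congr rfl fun s _ => ?_
        simp only [hwdef]
        rw [if_pos (hB s)]
      rw [this, Finset.prod_div_distrib]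
      simp only [Finset.prod_const, Finset.card_univ, Fintype.card_fin]
      rw [add_assoc, pow_add _ (R k), mul_div_assoc]
    · rw [if_neg (fun h => hB h.2.2)]
      push Not at hB
      obtain ⟨s, hs⟩ := hB
      rw [Finset.prod_eq_zero (Finset.mem_univ s), mul_zero]
      simp only [hwdef]
      rw [if_neg]
      rintro ⟨h1, h2⟩
      exact absurd h2 (not_le.mpr (hs h1))
  · rw [if_neg hA, if_neg (fun h => hA ⟨h.1, h.2.1⟩), mul_zero]
end

section
/- (Abstract form of Lemma 10.2) Let V be a finite set with an acyclic edge relation E, and let S ⊆ V carry a linear order < compatible with E-reachability; write S = {s₁ < s₂ < ⋯ < s_k}. Then for every i with 0 ≤ i ≤ k there exists a unique subset V₂ ⊆ V such that, with V₁ := V \ V₂: (a) there is no edge E(v₂, v₁) with v₂ ∈ V₂ and v₁ ∈ V₁; (b) V₂ ∩ S = {s₁, …, s_i}; and (c) every vertex of V₂ that has no E-in-neighbor inside V₂ belongs to S. -/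
/-- **Abstract form of Lemma 10.2.** Let `V` be a finite set with an acyclic edge relation
`E`, and let the special vertices `S ⊆ V` (a finite set `s₁ < s₂ < ⋯ < s_k` under a linear
order compatible with `E`-reachability).  Then for every `i ≤ k` there is a unique subset
`V₂ ⊆ V` such that, with `V₁ = V \ V₂`: (a) there is no edge from `V₂` to `V₁`;
(b) `V₂ ∩ S = {s₁, …, s_i}`; (c) every vertex of `V₂` with no `E`-in-neighbor inside `V₂`
belongs to `S`. -/
theorem unique_admissible_partition
    {V : Type*} [Fintype V] [DecidableEq V] (E : V → V → Prop)
    (hacyc : ∀ v, ¬ Relation.TransGen E v v)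
    (S : Finset V) [LinearOrder ↥S]
    (hcompat : ∀ s₁ s₂ : ↥S, Relation.TransGen E (s₁ : V) (s₂ : V) → s₂ < s₁)
    (e : Fin (Fintype.card ↥S) ≃o ↥S)
    (i : ℕ) (hi : i ≤ Fintype.card ↥S) :
    ∃! V₂ : Set V,
      (∀ v₂ ∈ V₂, ∀ v₁ ∉ V₂, ¬ E v₂ v₁) ∧
      (∀ s : ↥S, (s : V) ∈ V₂ ↔ (e.symm s : ℕ) < i) ∧
      (∀ v ∈ V₂, (∀ w ∈ V₂, ¬ E w v) → v ∈ S) := by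
  classical
  have hwf : WellFounded (Relation.TransGen E) := by
    haveI : Std.Irrefl (Relation.TransGen E) := ⟨hacyc⟩
    exact Finite.wellFounded_of_trans_of_irrefl _
  refine ⟨{v | ∃ s : ↥S, (e.symm s : ℕ) < i ∧ Relation.ReflTransGen E (s : V) v},
    ⟨?_, ?_, ?_⟩, ?_⟩
  · rintro v ⟨s, hs, hsv⟩ w hw hvw
    exact hw ⟨s, hs, hsv.tail hvw⟩
  · intro t
    constructor
    · rintro ⟨s, hs, hst⟩
      rcases Relation.reflTransGen_iff_eq_or_transGen.1 hst with h | h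
      · have h' : t = s := Subtype.ext h
        rw [h']
        exact hs
      · have h1 : e.symm t < e.symm s := e.symm.lt_iff_lt.2 (hcompat s t h)
        exact lt_trans h1 hs
    · intro h
      exact ⟨t, h, Relation.ReflTransGen.refl⟩
  · rintro v ⟨s, hs, hsv⟩ hno
    rcases Relation.ReflTransGen.cases_tail hsv with h | ⟨w, hw, hwv⟩
    · rw [h]
      exact s.2
    · exact absurd hwv (hno w ⟨s, hs, hw⟩)
  · rintro W ⟨ha, hb, hc⟩
    ext v
    constructor
    · intro hv
      induction v using hwf.induction with
      | _ v ih =>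
        by_cases hS : v ∈ S
        · exact ⟨⟨v, hS⟩, (hb ⟨v, hS⟩).1 hv, Relation.ReflTransGen.refl⟩
        · have : ∃ w ∈ W, E w v := by
            by_contra hcon
            exact hS (hc v hv fun w hw hwv => hcon ⟨w, hw, hwv⟩)
          obtain ⟨w, hw, hwv⟩ := this
          obtain ⟨s, hs, hsw⟩ := ih w (Relation.TransGen.single hwv) hw
          exact ⟨s, hs, hsw.tail hwv⟩
    · rintro ⟨s, hs, hsv⟩
      induction hsv with
      | refl => exact (hb s).2 hs
      | tail _ hbc ih =>
        by_contra hcon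
        exact ha _ ih _ hcon hbc
end
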